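/- If k ≥ 1 and n + l ≥ 2, then K_{n,k,l} is not finitely presentable: for every surjective group homomorphism π from a finitely generated free group F' onto K_{n,k,l}, the kernel of π is not the normal closure of any finite subset of F'. -/

import Mathlib

namespace Birman

/-- The generating set of the free group `F_{n,k,l}`: `X ∪ Y ∪ Z`. -/
abbrev Gen (n k l : ℕ) := Fin n ⊕ (Fin k ⊕ Fin l)

/-- The free group `F_{n,k,l}` on `X ∪ Y ∪ Z`. -/
abbrev FG (n k l : ℕ) := FreeGroup (Gen n k l)

variable {n k l : ℕ}

/-- The generator `x_i`. -/
def xg (n k l : ℕ) (i : Fin n) : Gen n k l := Sum.inl i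
/-- The generator `y_j`. -/
def yg (n k l : ℕ) (j : Fin k) : Gen n k l := Sum.inr (Sum.inl j)
/-- The generator `z_m`. -/
def zg (n k l : ℕ) (m : Fin l) : Gen n k l := Sum.inr (Sum.inr m)

/-- `A_{n,k,l}`: automorphisms sending each generator in `Y ∪ Z` to a conjugate of itself. -/
def A (n k l : ℕ) : Subgroup (MulAut (FG n k l)) where
  carrier := {f | ∀ s : Fin k ⊕ Fin l,
    IsConj (FreeGroup.of (Sum.inr s : Gen n k l)) (f (FreeGroup.of (Sum.inr s)))}
  one_mem' := by
    intro s
    rw [MulAut.one_apply]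
  mul_mem' := by
    intro f g hf hg s
    rw [MulAut.mul_apply]
    exact (hf s).trans (f.toMonoidHom.map_isConj (hg s))
  inv_mem' := by
    intro f hf s
    have h := (f⁻¹ : MulAut (FG n k l)).toMonoidHom.map_isConj (hf s)
    simp only [MulEquiv.toMonoidHom_eq_coe, MonoidHom.coe_coe] at h
    have h2 : (f⁻¹ : MulAut (FG n k l)) (f (FreeGroup.of (Sum.inr s))) = FreeGroup.of (Sum.inr s) :=
      MulAut.inv_apply_self _ f _
    rw [h2] at h
    exact h.symm

/-- The projection `F_{n,k,l} → F_{n,0,l}` killing the generators in `Y`. -/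
def proj (n k l : ℕ) : FG n k l →* FG n 0 l :=
  FreeGroup.lift fun g => match g with
    | Sum.inl i => FreeGroup.of (Sum.inl i)
    | Sum.inr (Sum.inl _) => 1
    | Sum.inr (Sum.inr m) => FreeGroup.of (Sum.inr (Sum.inr m))

/-- Automorphisms commuting with the projection to `F_{n,0,l}`, i.e. inducing the identity
on `F_{n,k,l}/N ≅ F_{n,0,l}`. -/
def fixProj (n k l : ℕ) : Subgroup (MulAut (FG n k l)) where
  carrier := {f | ∀ w : FG n k l, proj n k l (f w) = proj n k l w}
  one_mem' := by intro w; simp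
  mul_mem' := by
    intro f g hf hg w
    rw [MulAut.mul_apply]
    exact (hf (g w)).trans (hg w)
  inv_mem' := by
    intro f hf w
    have h := hf ((f⁻¹ : MulAut (FG n k l)) w)
    rw [MulAut.apply_inv_self] at h
    exact h.symm

/-- `K_{n,k,l}`, the kernel of `ρ : A_{n,k,l} → A_{n,0,l}`: those elements of `A_{n,k,l}`
that induce the identity automorphism of `F_{n,k,l}/N ≅ F_{n,0,l}`. -/
def K (n k l : ℕ) : Subgroup (MulAut (FG n k l)) := A n k l ⊓ fixProj n k l

/-- `f` is the automorphism `M_{v,w}` : `v ↦ w v`, fixing all other generators. -/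
def IsMul (f : MulAut (FG n k l)) (v w : Gen n k l) : Prop :=
  f (FreeGroup.of v) = FreeGroup.of w * FreeGroup.of v ∧
    ∀ u : Gen n k l, u ≠ v → f (FreeGroup.of u) = FreeGroup.of u

/-- `f` is the automorphism `M_{v⁻¹,w}` : `v ↦ v w⁻¹`, fixing all other generators. -/
def IsMulInv (f : MulAut (FG n k l)) (v w : Gen n k l) : Prop :=
  f (FreeGroup.of v) = FreeGroup.of v * (FreeGroup.of w)⁻¹ ∧
    ∀ u : Gen n k l, u ≠ v → f (FreeGroup.of u) = FreeGroup.of u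

/-- `f` is the automorphism `C_{v,w}` : `v ↦ w v w⁻¹`, fixing all other generators. -/
def IsConjGen (f : MulAut (FG n k l)) (v w : Gen n k l) : Prop :=
  f (FreeGroup.of v) = FreeGroup.of w * FreeGroup.of v * (FreeGroup.of w)⁻¹ ∧
    ∀ u : Gen n k l, u ≠ v → f (FreeGroup.of u) = FreeGroup.of u

end Birman

namespace Birman

variable {n k l : ℕ}

/-! ### The affine group of `ℚ` and Fox-type derivations -/

/-- Affine maps of `ℚ`. -/
@[ext] structure Aff where
  a : ℚ
  g : ℚˣ

namespace Aff

instance : Mul Aff := ⟨fun x y => ⟨x.a + x.g * y.a, x.g * y.g⟩⟩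
instance : One Aff := ⟨⟨0, 1⟩⟩
instance : Inv Aff := ⟨fun x => ⟨-((x.g⁻¹ : ℚˣ) * x.a), x.g⁻¹⟩⟩

@[simp] lemma mul_a (x y : Aff) : (x * y).a = x.a + x.g * y.a := rfl
@[simp] lemma mul_g (x y : Aff) : (x * y).g = x.g * y.g := rfl
@[simp] lemma one_a : (1 : Aff).a = 0 := rfl
@[simp] lemma one_g : (1 : Aff).g = 1 := rfl
@[simp] lemma inv_a (x : Aff) : (x⁻¹).a = -((x.g⁻¹ : ℚˣ) * x.a) := rfl
@[simp] lemma inv_g (x : Aff) : (x⁻¹).g = x.g⁻¹ := rfl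

instance : Group Aff := Group.ofLeftAxioms
  (by intro x y z; ext <;> simp <;> ring)
  (by intro x; ext <;> simp)
  (by intro x; ext <;> simp)

/-- The linear part. -/
def gHom : Aff →* ℚˣ where
  toFun := Aff.g
  map_one' := rfl
  map_mul' _ _ := rfl

end Aff

/-- The Heisenberg-like group: a central extension by `ℚ`. -/
@[ext] structure Heis where
  a : ℚ
  d : ℚ
  m : ℚ
  g : ℚˣ

namespace Heis

instance : Mul Heis := ⟨fun x y =>
  ⟨x.a + x.g * y.a, x.d + (x.g⁻¹ : ℚˣ) * y.d, x.m + y.m + x.a * (x.g⁻¹ : ℚˣ) * y.d, x.g * y.g⟩⟩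
instance : One Heis := ⟨⟨0, 0, 0, 1⟩⟩
instance : Inv Heis := ⟨fun x =>
  ⟨-((x.g⁻¹ : ℚˣ) * x.a), -(x.g * x.d), -x.m + x.a * x.d, x.g⁻¹⟩⟩

@[simp] lemma mul_a (x y : Heis) : (x * y).a = x.a + x.g * y.a := rfl
@[simp] lemma mul_d (x y : Heis) : (x * y).d = x.d + (x.g⁻¹ : ℚˣ) * y.d := rfl
@[simp] lemma mul_m (x y : Heis) :
    (x * y).m = x.m + y.m + x.a * (x.g⁻¹ : ℚˣ) * y.d := rfl
@[simp] lemma mul_g (x y : Heis) : (x * y).g = x.g * y.g := rfl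
@[simp] lemma one_a : (1 : Heis).a = 0 := rfl
@[simp] lemma one_d : (1 : Heis).d = 0 := rfl
@[simp] lemma one_m : (1 : Heis).m = 0 := rfl
@[simp] lemma one_g : (1 : Heis).g = 1 := rfl
@[simp] lemma inv_a (x : Heis) : (x⁻¹).a = -((x.g⁻¹ : ℚˣ) * x.a) := rfl
@[simp] lemma inv_d (x : Heis) : (x⁻¹).d = -(x.g * x.d) := rfl
@[simp] lemma inv_m (x : Heis) : (x⁻¹).m = -x.m + x.a * x.d := rfl
@[simp] lemma inv_g (x : Heis) : (x⁻¹).g = x.g⁻¹ := rfl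

instance : Group Heis := Group.ofLeftAxioms
  (by intro x y z; ext <;> simp <;> field_simp <;> ring)
  (by intro x; ext <;> simp)
  (by intro x; ext <;> simp <;> field_simp <;> ring)

end Heis

/-- The values of the derivation on generators. -/
def genVal (n k l : ℕ) (j0 : Fin k) (s : ℚˣ) : Gen n k l → Aff
  | Sum.inl _ => ⟨0, s⟩
  | Sum.inr (Sum.inl j) => ⟨if j = j0 then 1 else 0, 1⟩
  | Sum.inr (Sum.inr _) => ⟨0, s⟩

/-- The derivation, as a homomorphism to the affine group. -/
def Psi (n k l : ℕ) (j0 : Fin k) (s : ℚˣ) : FG n k l →* Aff :=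
  FreeGroup.lift (genVal n k l j0 s)

/-- The obvious section of `proj`. -/
def sect (n k l : ℕ) : FG n 0 l →* FG n k l :=
  FreeGroup.lift fun g => match g with
    | Sum.inl i => FreeGroup.of (Sum.inl i)
    | Sum.inr (Sum.inl j) => j.elim0
    | Sum.inr (Sum.inr m) => FreeGroup.of (Sum.inr (Sum.inr m))

/-- A homomorphism killing `Y` only depends on the projection. -/
lemma factor {G : Type*} [Group G] (h : FG n k l →* G)
    (hy : ∀ j, h (FreeGroup.of (Sum.inr (Sum.inl j))) = 1) (w w' : FG n k l)
    (hw : proj n k l w = proj n k l w') : h w = h w' := by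
  have key : h = (h.comp (sect n k l)).comp (proj n k l) := by
    apply FreeGroup.ext_hom
    rintro (i | j | m)
    · simp [proj, sect]
    · simp [proj, hy]
    · simp [proj, sect]
  rw [key]
  simp [hw]

lemma chi_eq (j0 : Fin k) (s : ℚˣ) {f : MulAut (FG n k l)} (hf : f ∈ K n k l) (w : FG n k l) :
    (Psi n k l j0 s (f w)).g = (Psi n k l j0 s w).g :=
  factor (Aff.gHom.comp (Psi n k l j0 s)) (by intro j; simp [Psi, genVal, Aff.gHom]) _ _ (hf.2 w)

/-- The action of `f` on the abelianised kernel. -/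
def gam (j0 : Fin k) (s : ℚˣ) (f : MulAut (FG n k l)) : ℚ :=
  (Psi n k l j0 s (f (FreeGroup.of (Sum.inr (Sum.inl j0))))).a

/-- The difference derivation. -/
def diffHom (j0 : Fin k) (s : ℚˣ) {f : MulAut (FG n k l)} (hf : f ∈ K n k l) :
    FG n k l →* Aff where
  toFun w := ⟨(Psi n k l j0 s (f w)).a - gam j0 s f * (Psi n k l j0 s w).a, (Psi n k l j0 s w).g⟩
  map_one' := by ext <;> simp
  map_mul' u v := by
    ext
    · simp [chi_eq j0 s hf]; ring
    · simp

lemma diffHom_y (j0 : Fin k) (s : ℚˣ) {f : MulAut (FG n k l)} (hf : f ∈ K n k l) (j : Fin k) :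
    diffHom j0 s hf (FreeGroup.of (Sum.inr (Sum.inl j))) = 1 := by
  by_cases hj : j = j0
  · subst hj
    ext
    · simp [diffHom, gam, Psi, genVal]
    · simp [diffHom, Psi, genVal]
  · obtain ⟨c, hc⟩ := isConj_iff.1 (hf.1 (Sum.inl j))
    have h1 : Psi n k l j0 s (FreeGroup.of (Sum.inr (Sum.inl j))) = 1 := by
      ext <;> simp [Psi, genVal, hj]
    have h2 : Psi n k l j0 s (f (FreeGroup.of (Sum.inr (Sum.inl j)))) = 1 := by
      rw [← hc]; simp [h1]
    ext <;> simp [diffHom, h1, h2]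

lemma der_comp (j0 : Fin k) (s : ℚˣ) {f f' : MulAut (FG n k l)} (hf : f ∈ K n k l)
    (hf' : f' ∈ K n k l) (w : FG n k l) :
    (Psi n k l j0 s ((f * f') w)).a = (Psi n k l j0 s (f w)).a - gam j0 s f * (Psi n k l j0 s w).a
      + gam j0 s f * (Psi n k l j0 s (f' w)).a := by
  have h := congrArg Aff.a
    (factor (diffHom j0 s hf) (diffHom_y j0 s hf) (f' w) w (hf'.2 w))
  simp only [diffHom, MonoidHom.coe_mk, OneHom.coe_mk] at h
  rw [MulAut.mul_apply]
  linarith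

lemma gam_mul (j0 : Fin k) (s : ℚˣ) {f f' : MulAut (FG n k l)} (hf : f ∈ K n k l)
    (hf' : f' ∈ K n k l) : gam j0 s (f * f') = gam j0 s f * gam j0 s f' := by
  have h := der_comp j0 s hf hf' (FreeGroup.of (Sum.inr (Sum.inl j0)))
  have h1 : (Psi n k l j0 s (FreeGroup.of (Sum.inr (Sum.inl j0)))).a = 1 := by simp [Psi, genVal]
  rw [h1] at h
  unfold gam at *
  linarith

lemma Psi_inv_g (j0 : Fin k) (s : ℚˣ) (w : FG n k l) :
    (Psi n k l j0 s⁻¹ w).g = ((Psi n k l j0 s w).g)⁻¹ := by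
  have : Aff.gHom.comp (Psi n k l j0 s⁻¹) = (Aff.gHom.comp (Psi n k l j0 s))⁻¹ := by
    apply FreeGroup.ext_hom
    rintro (i | j | m) <;> simp [Psi, genVal, Aff.gHom]
  exact DFunLike.congr_fun this w

lemma gam_eq (j0 : Fin k) {f : MulAut (FG n k l)} (hf : f ∈ K n k l) :
    ∃ c : FG n k l, ∀ s : ℚˣ, gam j0 s f = (Psi n k l j0 s c).g := by
  obtain ⟨c, hc⟩ := isConj_iff.1 (hf.1 (Sum.inl j0))
  refine ⟨c, fun s => ?_⟩
  unfold gam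
  rw [← hc]
  simp [Psi, genVal]

lemma gam_inv (j0 : Fin k) (s : ℚˣ) {f : MulAut (FG n k l)} (hf : f ∈ K n k l) :
    gam j0 s f * gam j0 s⁻¹ f = 1 := by
  obtain ⟨c, hc⟩ := gam_eq j0 hf
  rw [hc, hc, Psi_inv_g]
  simp

/-- Multiplier as a unit. -/
noncomputable def gamU (j0 : Fin k) (s : ℚˣ) (f : K n k l) : ℚˣ where
  val := gam j0 s f.1
  inv := gam j0 s⁻¹ f.1
  val_inv := gam_inv j0 s f.2
  inv_val := by rw [mul_comm]; exact gam_inv j0 s f.2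

/-- The generator is not in `Y`. -/
def NotY (v : Gen n k l) : Prop := ∀ j, v ≠ Sum.inr (Sum.inl j)

lemma Psi_notY (j0 : Fin k) (s : ℚˣ) {v : Gen n k l} (hv : NotY v) :
    Psi n k l j0 s (FreeGroup.of v) = ⟨0, s⟩ := by
  rcases v with i | j | m
  · simp [Psi, genVal]
  · exact absurd rfl (hv j)
  · simp [Psi, genVal]

lemma Psi_y (j0 : Fin k) (s : ℚˣ) :
    Psi n k l j0 s (FreeGroup.of (Sum.inr (Sum.inl j0))) = ⟨1, 1⟩ := by
  simp [Psi, genVal]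

lemma der_comp_v (j0 : Fin k) (s : ℚˣ) {f f' : MulAut (FG n k l)} (hf : f ∈ K n k l)
    (hf' : f' ∈ K n k l) {v : Gen n k l} (hv : NotY v) :
    (Psi n k l j0 s ((f * f') (FreeGroup.of v))).a = (Psi n k l j0 s (f (FreeGroup.of v))).a
      + gam j0 s f * (Psi n k l j0 s (f' (FreeGroup.of v))).a := by
  rw [der_comp j0 s hf hf', Psi_notY j0 s hv]; ring

/-- The multiplier `2`. -/
def two : ℚˣ := Units.mk0 2 two_ne_zero

/-- Set-theoretic lift of an element of `K` to the Heisenberg-like group. -/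
noncomputable def lft (j0 : Fin k) (v1 v2 : Gen n k l) (f : K n k l) : Heis where
  a := (Psi n k l j0 two (f.1 (FreeGroup.of v2))).a
  d := (Psi n k l j0 two⁻¹ (f.1 (FreeGroup.of v1))).a
  m := 0
  g := gamU j0 two f

/-- `x` lifts `f`. -/
def Lifts (j0 : Fin k) (v1 v2 : Gen n k l) (f : K n k l) (x : Heis) : Prop :=
  x.a = (Psi n k l j0 two (f.1 (FreeGroup.of v2))).a ∧
  x.d = (Psi n k l j0 two⁻¹ (f.1 (FreeGroup.of v1))).a ∧
  (x.g : ℚ) = gam j0 two f.1 ∧ ((x.g⁻¹ : ℚˣ) : ℚ) = gam j0 two⁻¹ f.1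

lemma Lifts.mul {j0 : Fin k} {v1 v2 : Gen n k l} (h1 : NotY v1) (h2 : NotY v2)
    {f f' : K n k l} {x x' : Heis} (h : Lifts j0 v1 v2 f x) (h' : Lifts j0 v1 v2 f' x') :
    Lifts j0 v1 v2 (f * f') (x * x') := by
  obtain ⟨a1, a2, a3, a4⟩ := h
  obtain ⟨b1, b2, b3, b4⟩ := h'
  refine ⟨?_, ?_, ?_, ?_⟩
  · rw [Subgroup.coe_mul, der_comp_v j0 two f.2 f'.2 h2, Heis.mul_a, a1, b1, a3]
  · rw [Subgroup.coe_mul, der_comp_v j0 two⁻¹ f.2 f'.2 h1, Heis.mul_d, a2, b2, a4]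
  · rw [Subgroup.coe_mul, gam_mul j0 two f.2 f'.2, Heis.mul_g, Units.val_mul, a3, b3]
  · rw [Subgroup.coe_mul, gam_mul j0 two⁻¹ f.2 f'.2, Heis.mul_g, mul_inv, Units.val_mul, a4, b4]

lemma Lifts.one {j0 : Fin k} {v1 v2 : Gen n k l} (h1 : NotY v1) (h2 : NotY v2) :
    Lifts j0 v1 v2 (1 : K n k l) 1 := by
  refine ⟨?_, ?_, ?_, ?_⟩
  · simp [Psi_notY j0 _ h2]
  · simp [Psi_notY j0 _ h1]
  · simp [gam, Psi_y]
  · simp [gam, Psi_y]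

/-- Lifts are unique up to the centre. -/
lemma Lifts.unique {j0 : Fin k} {v1 v2 : Gen n k l} {f : K n k l} {x x' : Heis}
    (h : Lifts j0 v1 v2 f x) (h' : Lifts j0 v1 v2 f x') :
    x.a = x'.a ∧ x.d = x'.d ∧ x.g = x'.g :=
  ⟨h.1.trans h'.1.symm, h.2.1.trans h'.2.1.symm, Units.ext (h.2.2.1.trans h'.2.2.1.symm)⟩

lemma Lifts.inv {j0 : Fin k} {v1 v2 : Gen n k l} (h1 : NotY v1) (h2 : NotY v2)
    {f : K n k l} {x : Heis} (h : Lifts j0 v1 v2 f x) :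
    Lifts j0 v1 v2 f⁻¹ x⁻¹ := by
  have hl : Lifts j0 v1 v2 f⁻¹ (lft j0 v1 v2 f⁻¹) := ⟨rfl, rfl, rfl, rfl⟩
  have hm := hl.mul h1 h2 h
  rw [inv_mul_cancel] at hm
  obtain ⟨e1, e2, e3⟩ := hm.unique (Lifts.one h1 h2)
  simp only [Heis.mul_a, Heis.mul_d, Heis.mul_g, Heis.one_a, Heis.one_d, Heis.one_g] at e1 e2 e3
  have egi := eq_inv_of_mul_eq_one_left e3
  rw [egi] at e1 e2
  obtain ⟨c1, c2, c3, c4⟩ := hl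
  refine ⟨?_, ?_, ?_, ?_⟩
  · rw [← c1, Heis.inv_a]; linarith
  · rw [← c2, Heis.inv_d]; rw [inv_inv] at e2; linarith
  · rw [← c3, Heis.inv_g, egi]
  · rw [← c4, Heis.inv_g, egi]

/-- The lift of `π` to the Heisenberg-like group. -/
noncomputable def phi (j0 : Fin k) (v1 v2 : Gen n k l) {m : ℕ}
    (π : FreeGroup (Fin m) →* K n k l) : FreeGroup (Fin m) →* Heis :=
  FreeGroup.lift fun i => lft j0 v1 v2 (π (FreeGroup.of i))

lemma phi_lifts (j0 : Fin k) {v1 v2 : Gen n k l} (h1 : NotY v1) (h2 : NotY v2) {m : ℕ}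
    (π : FreeGroup (Fin m) →* K n k l) (w : FreeGroup (Fin m)) :
    Lifts j0 v1 v2 (π w) (phi j0 v1 v2 π w) := by
  induction w using FreeGroup.induction_on with
  | C1 => rw [map_one, map_one]; exact Lifts.one h1 h2
  | of i =>
    have : phi j0 v1 v2 π (FreeGroup.of i) = lft j0 v1 v2 (π (FreeGroup.of i)) := by simp [phi]
    show Lifts j0 v1 v2 (π (FreeGroup.of i)) (phi j0 v1 v2 π (FreeGroup.of i))
    rw [this]
    exact ⟨rfl, rfl, rfl, rfl⟩
  | inv_of i h => rw [map_inv, map_inv]; exact h.inv h1 h2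
  | mul x y hx hy => rw [map_mul, map_mul]; exact hx.mul h1 h2 hy

/-! ### The explicit commuting pairs -/

/-- Conjugating the generator `v` by `u`. -/
def cHom (v : Gen n k l) (u : FG n k l) : FG n k l →* FG n k l :=
  FreeGroup.lift fun g => if g = v then u * FreeGroup.of v * u⁻¹ else FreeGroup.of g

lemma cHom_v (v : Gen n k l) (u : FG n k l) :
    cHom v u (FreeGroup.of v) = u * FreeGroup.of v * u⁻¹ := by simp [cHom]

lemma cHom_ne {v g : Gen n k l} (u : FG n k l) (h : g ≠ v) :
    cHom v u (FreeGroup.of g) = FreeGroup.of g := by simp [cHom, h]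

lemma cHom_comp {v : Gen n k l} {u u' : FG n k l} (h : u' * u = 1) (hu : cHom v u u' = u') :
    (cHom v u).comp (cHom v u') = MonoidHom.id _ := by
  apply FreeGroup.ext_hom
  intro g
  by_cases hg : g = v
  · subst hg
    have : u' = u⁻¹ := eq_inv_of_mul_eq_one_left h
    simp only [MonoidHom.comp_apply, cHom_v, map_mul, map_inv, hu, MonoidHom.id_apply]
    rw [this]; group
  · simp [cHom_ne _ hg]

/-- The partial conjugation as an automorphism. -/
def cAut (v : Gen n k l) (u : FG n k l) (hu : cHom v u u = u) (hu' : cHom v u⁻¹ u = u) :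
    MulAut (FG n k l) :=
  MonoidHom.toMulEquiv (cHom v u) (cHom v u⁻¹)
    (cHom_comp (by group) hu')
    (cHom_comp (by group) (by rw [map_inv, hu]))

/-- The conjugating word `v₂^p y v₂^{-p}`. -/
def uw (j0 : Fin k) (v2 : Gen n k l) (p : ℕ) : FG n k l :=
  FreeGroup.of v2 ^ p * FreeGroup.of (Sum.inr (Sum.inl j0)) * (FreeGroup.of v2 ^ p)⁻¹

lemma cHom_uw (j0 : Fin k) {v1 v2 : Gen n k l} (h1 : NotY v1) (h : v2 ≠ v1) (p : ℕ)
    (u : FG n k l) : cHom v1 u (uw j0 v2 p) = uw j0 v2 p := by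
  have hyv : (Sum.inr (Sum.inl j0) : Gen n k l) ≠ v1 := (h1 j0).symm
  simp only [uw, map_mul, map_inv, map_pow, cHom_ne _ h, cHom_ne _ hyv]

/-- The automorphism `a_p`. -/
def aAut (j0 : Fin k) {v1 v2 : Gen n k l} (h1 : NotY v1) (h : v2 ≠ v1) (p : ℕ) :
    MulAut (FG n k l) :=
  cAut v1 (uw j0 v2 p) (cHom_uw j0 h1 h p _) (cHom_uw j0 h1 h p _)

lemma aAut_apply (j0 : Fin k) {v1 v2 : Gen n k l} (h1 : NotY v1) (h : v2 ≠ v1) (p : ℕ)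
    (w : FG n k l) : aAut j0 h1 h p w = cHom v1 (uw j0 v2 p) w := rfl

lemma proj_y (j : Fin k) : proj n k l (FreeGroup.of (Sum.inr (Sum.inl j))) = 1 := by simp [proj]

lemma aAut_mem (j0 : Fin k) {v1 v2 : Gen n k l} (h1 : NotY v1) (h : v2 ≠ v1) (p : ℕ) :
    aAut j0 h1 h p ∈ K n k l := by
  constructor
  · intro s
    rw [aAut_apply]
    by_cases hs : (Sum.inr s : Gen n k l) = v1
    · rw [hs, cHom_v]
      exact isConj_iff.2 ⟨_, rfl⟩
    · rw [cHom_ne _ hs]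
  · intro w
    rw [aAut_apply]
    have : (proj n k l).comp (cHom v1 (uw j0 v2 p)) = proj n k l := by
      apply FreeGroup.ext_hom
      intro g
      by_cases hg : g = v1
      · subst hg
        simp [cHom_v, uw, proj_y]
      · simp [cHom_ne _ hg]
    exact DFunLike.congr_fun this w

lemma iAut_mem (j0 : Fin k) :
    MulAut.conj (FreeGroup.of (Sum.inr (Sum.inl j0)) : FG n k l) ∈ K n k l := by
  constructor
  · intro s
    exact isConj_iff.2 ⟨FreeGroup.of (Sum.inr (Sum.inl j0)), rfl⟩
  · intro w
    simp [proj_y]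

lemma commute_ai (j0 : Fin k) {v1 v2 : Gen n k l} (h1 : NotY v1) (h : v2 ≠ v1) (p : ℕ) :
    aAut j0 h1 h p * MulAut.conj (FreeGroup.of (Sum.inr (Sum.inl j0)))
      = MulAut.conj (FreeGroup.of (Sum.inr (Sum.inl j0))) * aAut j0 h1 h p := by
  have hyv : (Sum.inr (Sum.inl j0) : Gen n k l) ≠ v1 := (h1 j0).symm
  ext w
  simp [aAut_apply, cHom_ne _ hyv]

/-- The commutator of lifts of the commuting pair. -/
lemma comm_val (j0 : Fin k) {v1 v2 : Gen n k l} (h1 : NotY v1) (h2 : NotY v2) (h : v2 ≠ v1)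
    (p : ℕ) {x y : Heis}
    (hx : Lifts j0 v1 v2 (⟨_, iAut_mem j0⟩ : K n k l) x)
    (hy : Lifts j0 v1 v2 (⟨_, aAut_mem j0 h1 h p⟩ : K n k l) y) :
    (x * y * x⁻¹ * y⁻¹).m = -(1/2) ^ (p + 1) := by
  have hyv : (Sum.inr (Sum.inl j0) : Gen n k l) ≠ v1 := (h1 j0).symm
  have hP : ∀ s : ℚˣ, Psi n k l j0 s (FreeGroup.of v2 ^ p) = ⟨0, s ^ p⟩ := by
    intro s
    rw [map_pow, Psi_notY j0 s h2]
    clear hx hy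
    induction p with
    | zero => simp; rfl
    | succ q ih => rw [pow_succ, ih]; ext <;> simp [pow_succ]
  obtain ⟨a1, a2, a3, -⟩ := hx
  obtain ⟨b1, b2, b3, -⟩ := hy
  have hxg : x.g = 1 := Units.ext (by rw [a3]; simp [gam, Psi_y])
  have hyg : y.g = 1 := Units.ext (by rw [b3]; simp [gam, aAut_apply, cHom_ne _ hyv, Psi_y])
  have hxa : x.a = -1 := by
    rw [a1]; simp [Psi_y, Psi_notY j0 _ h2, two]; norm_num
  have hya : y.a = 0 := by
    rw [b1]; simp [aAut_apply, cHom_ne _ h, Psi_notY j0 _ h2]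
  have hyd : y.d = (1/2) ^ (p + 1) := by
    rw [b2]; simp [aAut_apply, cHom_v, uw, hP, Psi_y, Psi_notY j0 _ h1, two]
    rw [pow_succ]; ring
  simp [hxg, hyg, hxa, hya, hyd]
  try ring

lemma exists_pair (n k l : ℕ) (hnl : 2 ≤ n + l) :
    ∃ v1 v2 : Gen n k l, NotY v1 ∧ NotY v2 ∧ v2 ≠ v1 := by
  have hc : 1 < Fintype.card (Fin n ⊕ Fin l) := by simp; omega
  obtain ⟨a, b, hab⟩ := Fintype.exists_pair_of_one_lt_card hc
  let e : Fin n ⊕ Fin l → Gen n k l := Sum.map id Sum.inr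
  have he : Function.Injective e := Function.Injective.sumMap Function.injective_id Sum.inr_injective
  have hN : ∀ c, NotY (e c) := by
    rintro (c | c) j <;> simp [e]
  exact ⟨e a, e b, hN a, hN b, fun hh => hab (he hh).symm⟩

/-- **Theorem B (not finitely presentable).**  If `k ≥ 1` and `n + l ≥ 2`, then `K_{n,k,l}` is
not finitely presentable: for every surjection `π` from a finitely generated free group onto
`K_{n,k,l}`, the kernel of `π` is not the normal closure of any finite subset. -/
theorem K_not_finitely_presentable (n k l : ℕ) (hk : 1 ≤ k) (hnl : 2 ≤ n + l)
    (m : ℕ) (π : FreeGroup (Fin m) →* ↥(K n k l)) (hπ : Function.Surjective π) :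
    ¬ ∃ T : Finset (FreeGroup (Fin m)),
        Subgroup.normalClosure (T : Set (FreeGroup (Fin m))) = π.ker := by
  rintro ⟨T, hT⟩
  obtain ⟨v1, v2, h1, h2, hne⟩ := exists_pair n k l hnl
  let j0 : Fin k := ⟨0, hk⟩
  have hφ := phi_lifts j0 h1 h2 π
  set φ := phi j0 v1 v2 π with hφdef
  have hker : ∀ w ∈ π.ker, (φ w).a = 0 ∧ (φ w).d = 0 ∧ (φ w).g = 1 := by
    intro w hw
    have := hφ w
    rw [MonoidHom.mem_ker.1 hw] at this
    exact this.unique (Lifts.one h1 h2)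
  -- a common denominator of the values on `T`
  let N : ℕ := ∏ t ∈ T, (φ t).m.den
  have hN : N ≠ 0 := Finset.prod_ne_zero_iff.2 fun t _ => (φ t).m.den_nz
  let P : Subgroup (FreeGroup (Fin m)) :=
    { carrier := {w | w ∈ π.ker ∧ ∃ z : ℤ, (N : ℚ) * (φ w).m = z}
      one_mem' := ⟨one_mem _, 0, by simp⟩
      mul_mem' := by
        rintro a b ⟨ha, za, hza⟩ ⟨hb, zb, hzb⟩
        refine ⟨mul_mem ha hb, za + zb, ?_⟩
        have := hker a ha
        rw [map_mul, Heis.mul_m, this.1]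
        push_cast
        rw [← hza, ← hzb]; ring
      inv_mem' := by
        rintro a ⟨ha, za, hza⟩
        refine ⟨inv_mem ha, -za, ?_⟩
        have := hker a ha
        rw [map_inv, Heis.inv_m, this.1]
        push_cast
        rw [← hza]; ring }
  have hPn : P.Normal := by
    constructor
    rintro a ⟨ha, za, hza⟩ g
    refine ⟨(MonoidHom.normal_ker π).conj_mem a ha g, za, ?_⟩
    obtain ⟨e1, e2, e3⟩ := hker a ha
    have : φ (g * a * g⁻¹) = φ a := by
      rw [map_mul, map_mul, map_inv, mul_inv_eq_iff_eq_mul]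
      ext <;> simp [e1, e2, e3, add_comm]
    rw [this, hza]
  have hTP : (T : Set (FreeGroup (Fin m))) ⊆ P := by
    intro t ht
    refine ⟨hT ▸ Subgroup.subset_normalClosure ht, ?_⟩
    obtain ⟨c, hc⟩ : (φ t).m.den ∣ N := Finset.dvd_prod_of_mem (fun t => (φ t).m.den) ht
    refine ⟨c * (φ t).m.num, ?_⟩
    have hd := Rat.mul_den_eq_num (φ t).m
    rw [hc]
    push_cast
    rw [← hd]; ring
  have hle : π.ker ≤ P := hT ▸ Subgroup.normalClosure_le_normal hTP
  have key : ∀ p : ℕ, ∃ z : ℤ, (N : ℚ) * (-(1/2) ^ (p + 1)) = z := by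
    intro p
    obtain ⟨w, hw⟩ := hπ ⟨_, iAut_mem j0⟩
    obtain ⟨w', hw'⟩ := hπ ⟨_, aAut_mem j0 h1 hne p⟩
    have hmem : w * w' * w⁻¹ * w'⁻¹ ∈ π.ker := by
      rw [MonoidHom.mem_ker, map_mul, map_mul, map_mul, map_inv, map_inv, mul_inv_eq_one,
        mul_inv_eq_iff_eq_mul, hw, hw']
      exact Subtype.ext (commute_ai j0 h1 hne p).symm
    obtain ⟨z, hz⟩ := (hle hmem).2
    have hc := comm_val j0 h1 h2 hne p (hw ▸ hφ w) (hw' ▸ hφ w')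
    refine ⟨z, ?_⟩
    rw [← hz, ← hc]
    simp only [map_mul, map_inv]
  obtain ⟨z, hz⟩ := key N
  have hlt : N < 2 ^ (N + 1) := (Nat.lt_two_pow_self).trans_le
    (Nat.pow_le_pow_right (by norm_num) (Nat.le_succ N))
  have h3 : (N : ℤ) = -z * 2 ^ (N + 1) := by
    have : (N : ℚ) = -z * 2 ^ (N + 1) := by
      rw [← hz, one_div, inv_pow]; field_simp
    exact_mod_cast this
  have h4 : ((2 : ℤ) ^ (N + 1)) ∣ N := ⟨-z, by rw [h3]; ring⟩
  have h5 : 2 ^ (N + 1) ∣ N := by exact_mod_cast h4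
  exact absurd (Nat.le_of_dvd (Nat.pos_of_ne_zero hN) h5) (not_le.2 hlt)

end Birman
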